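/- arXiv:2504.18177 — 5 statements merged into one kernel-verified Lean document; each statement's English description precedes it below -/
import Mathlib

section
/- Hermite tail estimate (essence of Lemma 2.1): let G : ℝ → ℂ be a Schwartz function, let p ∈ ℕ, and let N ∈ ℕ. Denote by A the operator (A G)(y) = y² G(y) − G''(y) and by G_k = ∫_ℝ G(y) Φ_k(y) dy the Hermite coefficients of G. Then Σ_{k > N} |G_k|² ≤ (2N+3)^{−2p} ∫_ℝ |(A^p G)(y)|² dy. -/
open MeasureTheory

noncomputable section

/-- Mixed partial derivative `∂_x^b ∂_y^β` of a function `f(x,y)`. -/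
def pd2 (b β : ℕ) (f : ℝ → ℝ → ℂ) (x y : ℝ) : ℂ :=
  iteratedDeriv b (fun x' => iteratedDeriv β (fun y' => f x' y') y) x

/-- Weighted derivative `x^a ∂_x^b y^α ∂_y^β` of `f(x,y)`. -/
def wD (a b α β : ℕ) (f : ℝ → ℝ → ℂ) (x y : ℝ) : ℂ :=
  (x : ℂ) ^ a * (y : ℂ) ^ α * pd2 b β f x y

/-- Uncurried version of a two-variable function. -/
def unc (f : ℝ → ℝ → ℂ) : ℝ × ℝ → ℂ := fun p => f p.1 p.2

/-- L² norm over ℝ². -/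
def L2 (f : ℝ → ℝ → ℂ) : ℝ := (eLpNorm (unc f) 2 (volume : Measure (ℝ × ℝ))).toReal

/-- L² norm over ℝ. -/
def L2one (f : ℝ → ℂ) : ℝ := (eLpNorm f 2 (volume : Measure ℝ)).toReal

/-- Schwartz-class predicate for smooth functions of two real variables. -/
def IsSchwartz2 (f : ℝ → ℝ → ℂ) : Prop :=
  ContDiff ℝ (⊤ : ℕ∞) (unc f) ∧
    ∀ k n : ℕ, ∃ C : ℝ, ∀ p : ℝ × ℝ, ‖p‖ ^ k * ‖iteratedFDeriv ℝ n (unc f) p‖ ≤ C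

/-- Schwartz-class predicate for smooth functions of one real variable. -/
def IsSchwartz1 (f : ℝ → ℂ) : Prop :=
  ContDiff ℝ (⊤ : ℕ∞) f ∧ ∀ k n : ℕ, ∃ C : ℝ, ∀ x : ℝ, |x| ^ k * ‖iteratedDeriv n f x‖ ≤ C

/-- Time derivative of a time-dependent two-variable function. -/
def dtR (R : ℝ → ℝ → ℝ → ℂ) (t x y : ℝ) : ℂ := deriv (fun s => R s x y) t

/-- For all `a b α β`, the map `t ↦ x^a ∂_x^b y^α ∂_y^β R(t,·,·)` is continuously
differentiable from `[0,∞)` into `L²(ℝ²)` with derivative `x^a ∂_x^b y^α ∂_y^β ∂_t R(t,·,·)`. -/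
def C1intoL2 (R : ℝ → ℝ → ℝ → ℂ) : Prop :=
  ∀ a b α β : ℕ, ∃ Ψ Ψ' : ℝ → Lp ℂ 2 (volume : Measure (ℝ × ℝ)),
    (∀ t : ℝ, 0 ≤ t → (Ψ t : ℝ × ℝ → ℂ) =ᵐ[volume] unc (wD a b α β (R t))) ∧
    (∀ t : ℝ, 0 ≤ t → (Ψ' t : ℝ × ℝ → ℂ) =ᵐ[volume] unc (wD a b α β (dtR R t))) ∧
    (∀ t : ℝ, 0 ≤ t → HasDerivWithinAt Ψ (Ψ' t) (Set.Ici 0) t) ∧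
    ContinuousOn Ψ' (Set.Ici 0)

/-- Regularity part of the notion of strong solution on `[0,∞) × ℝ²`. -/
def IsRegularSol (R : ℝ → ℝ → ℝ → ℂ) : Prop :=
  ContDiffOn ℝ (⊤ : ℕ∞) (fun p : ℝ × ℝ × ℝ => R p.1 p.2.1 p.2.2) {p : ℝ × ℝ × ℝ | 0 ≤ p.1} ∧
  (∀ t : ℝ, 0 ≤ t → IsSchwartz2 (R t)) ∧ C1intoL2 R

/-- Strong solution of the von Neumann equation in Weyl variables. -/
def IsVNSol (hbar : ℝ) (V : ℝ → ℝ) (R : ℝ → ℝ → ℝ → ℂ) : Prop :=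
  IsRegularSol R ∧
  ∀ t : ℝ, 0 ≤ t → ∀ x y : ℝ,
    dtR R t x y = Complex.I * pd2 1 1 (R t) x y -
      Complex.I * (((V (x + hbar * y / 2) - V (x - hbar * y / 2)) / hbar : ℝ) : ℂ) * R t x y

/-- Strong solution of the semiclassical equation. -/
def IsSCSol (V : ℝ → ℝ) (R : ℝ → ℝ → ℝ → ℂ) : Prop :=
  IsRegularSol R ∧
  ∀ t : ℝ, 0 ≤ t → ∀ x y : ℝ,
    dtR R t x y = Complex.I * pd2 1 1 (R t) x y -
      Complex.I * ((deriv V x * y : ℝ) : ℂ) * R t x y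

/-- The weighted Sobolev functional `𝒩_m` applied to a function of `(x,y)`. -/
def NN (m : ℕ) (f : ℝ → ℝ → ℂ) : ℝ :=
  ∑ q ∈ Finset.filter
      (fun q : ℕ × ℕ × ℕ × ℕ => q.1 + q.2.1 + q.2.2.1 + q.2.2.2 ≤ m)
      (Finset.range (m+1) ×ˢ Finset.range (m+1) ×ˢ Finset.range (m+1) ×ˢ Finset.range (m+1)),
    L2 (wD q.1 q.2.1 q.2.2.1 q.2.2.2 f)

/-- Supremum norm of a real-valued function. -/
def supN (f : ℝ → ℝ) : ℝ := ⨆ x : ℝ, |f x|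

/-- The constant `C_m[V]`. -/
def CmV (m : ℕ) (V : ℝ → ℝ) : ℝ :=
  ((m : ℝ)^2 + 2*m + m * supN (iteratedDeriv 2 V) + m * |deriv V 0|) +
    2^m * (1+m) * m * (⨆ n ∈ Finset.Icc 2 (m+1), supN (iteratedDeriv n V))

/-- Physicists' Hermite polynomial. -/
def Hpoly (k : ℕ) (y : ℝ) : ℝ :=
  (-1)^k * Real.exp (y^2) * iteratedDeriv k (fun z => Real.exp (-z^2)) y

/-- Hermite function `Φ_k`. -/
def Φh (k : ℕ) (y : ℝ) : ℝ :=
  ((2:ℝ)^k * (Nat.factorial k : ℝ) * Real.sqrt Real.pi) ^ (-(1:ℝ)/2) *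
    Real.exp (-y^2/2) * Hpoly k y

/-- The operator `𝒟 u = ∂_x u + V'(x) u`. -/
def Dop (V : ℝ → ℝ) (u : ℝ → ℂ) (x : ℝ) : ℂ := deriv u x + ((deriv V x : ℝ) : ℂ) * u x

/-- The operator `𝒟* u = −∂_x u + V'(x) u`. -/
def Dstar (V : ℝ → ℝ) (u : ℝ → ℂ) (x : ℝ) : ℂ := -deriv u x + ((deriv V x : ℝ) : ℂ) * u x

/-- The quantum correction `ℰ^ħ(x,y)`. -/
def Eh (hbar : ℝ) (V : ℝ → ℝ) (x y : ℝ) : ℝ :=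
  (V (x + hbar * y / 2) - V (x - hbar * y / 2)) / hbar - deriv V x * y

/-- Matrix elements `ℰ^ħ_{k,l}(x)` of the quantum correction. -/
def Ekl (hbar : ℝ) (V : ℝ → ℝ) (k l : ℕ) (x : ℝ) : ℝ :=
  ∫ y : ℝ, Eh hbar V x y * Φh k y * Φh l y

/-- `t ↦ u(t,·)` is continuously differentiable from `[0,∞)` into `L²(ℝ)` with
derivative `∂_t u`. -/
def C1intoL2one (u : ℝ → ℝ → ℂ) : Prop :=
  ∃ Ψ Ψ' : ℝ → Lp ℂ 2 (volume : Measure ℝ),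
    (∀ t : ℝ, 0 ≤ t → (Ψ t : ℝ → ℂ) =ᵐ[volume] u t) ∧
    (∀ t : ℝ, 0 ≤ t → (Ψ' t : ℝ → ℂ) =ᵐ[volume] fun x => deriv (fun s => u s x) t) ∧
    (∀ t : ℝ, 0 ≤ t → HasDerivWithinAt Ψ (Ψ' t) (Set.Ici 0) t) ∧
    ContinuousOn Ψ' (Set.Ici 0)

/-- Regularity part of the notion of strong solution of a Hermite–Galerkin system of size `N`;
the convention `R_k = 0` for `k > N` is included. -/
def IsGalerkinReg (N : ℕ) (R : ℕ → ℝ → ℝ → ℂ) : Prop :=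
  (∀ k, k ≤ N → ContDiffOn ℝ (⊤ : ℕ∞) (fun p : ℝ × ℝ => R k p.1 p.2) {p : ℝ × ℝ | 0 ≤ p.1}) ∧
  (∀ k, k ≤ N → ∀ t : ℝ, 0 ≤ t → IsSchwartz1 (R k t)) ∧
  (∀ k, k ≤ N → C1intoL2one (R k)) ∧
  (∀ k, N < k → ∀ t x : ℝ, R k t x = 0)

/-- Strong solution of the semiclassical Hermite–Galerkin system of size `N`.
(For `k = 0` the coefficient `√(k/2)` vanishes, so the term `R_{k-1}` is harmless.) -/
def IsSCGalerkinSol (V : ℝ → ℝ) (N : ℕ) (R : ℕ → ℝ → ℝ → ℂ) : Prop :=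
  IsGalerkinReg N R ∧
  ∀ k, k ≤ N → ∀ t : ℝ, 0 ≤ t → ∀ x : ℝ,
    deriv (fun s => R k s x) t +
      Complex.I * ((Real.sqrt ((k : ℝ)/2) : ℂ) * Dop V (R (k-1) t) x +
        (Real.sqrt (((k : ℝ)+1)/2) : ℂ) * Dstar V (R (k+1) t) x) = 0

/-- Strong solution of the von Neumann Hermite–Galerkin system of size `N`. -/
def IsVNGalerkinSol (hbar : ℝ) (V : ℝ → ℝ) (N : ℕ) (R : ℕ → ℝ → ℝ → ℂ) : Prop :=
  IsGalerkinReg N R ∧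
  ∀ k, k ≤ N → ∀ t : ℝ, 0 ≤ t → ∀ x : ℝ,
    deriv (fun s => R k s x) t +
      Complex.I * ((Real.sqrt ((k : ℝ)/2) : ℂ) * Dop V (R (k-1) t) x +
        (Real.sqrt (((k : ℝ)+1)/2) : ℂ) * Dstar V (R (k+1) t) x) =
      -Complex.I * ∑ l ∈ Finset.range (N+1), ((Ekl hbar V k l x : ℝ) : ℂ) * R l t x

/-- Smooth potential with all derivatives of order `≥ 2` bounded. -/
def SmoothBounded (V : ℝ → ℝ) : Prop :=
  ContDiff ℝ (⊤ : ℕ∞) V ∧ ∀ n : ℕ, 2 ≤ n → ∃ C : ℝ, ∀ x : ℝ, |iteratedDeriv n V x| ≤ C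

/-- The harmonic-oscillator operator `A G = y² G − G''`. -/
def Aop (g : ℝ → ℂ) : ℝ → ℂ := fun y => (y : ℂ)^2 * g y - iteratedDeriv 2 g y

open scoped SchwartzMap

namespace HermiteTail

/-- A real polynomial times the Gaussian `e^{-y²/2}` is bounded. -/
lemma exists_bound_polynomial_mul_gaussian (P : Polynomial ℝ) :
    ∃ C : ℝ, ∀ x : ℝ, |P.eval x| * Real.exp (-(x ^ 2 / 2)) ≤ C := by
  induction P using Polynomial.induction_on' with
  | add P Q hP hQ =>
    obtain ⟨C, hC⟩ := hP
    obtain ⟨C', hC'⟩ := hQ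
    refine ⟨C + C', fun x => ?_⟩
    rw [Polynomial.eval_add]
    have h := mul_le_mul_of_nonneg_right (abs_add_le (P.eval x) (Q.eval x))
      (Real.exp_nonneg (-(x ^ 2 / 2)))
    linarith [hC x, hC' x]
  | monomial n a =>
    refine ⟨|a| * (1 + 2 ^ n * n.factorial), fun x => ?_⟩
    have hexp : 0 < Real.exp (x ^ 2 / 2) := Real.exp_pos _
    have h1 : (1 : ℝ) ≤ Real.exp (x ^ 2 / 2) := Real.one_le_exp (by positivity)
    have h2 : (x ^ 2) ^ n ≤ 2 ^ n * n.factorial * Real.exp (x ^ 2 / 2) := by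
      have h := Real.pow_div_factorial_le_exp (x ^ 2 / 2) (by positivity) n
      rw [div_pow, div_div, div_le_iff₀ (by positivity)] at h
      linarith
    have h3 : |x| ^ n ≤ 1 + (x ^ 2) ^ n := by
      have h : (x ^ 2) ^ n = (|x| ^ n) ^ 2 := by
        rw [← sq_abs x]
        ring
      rw [h]
      nlinarith [sq_nonneg (|x| ^ n - 1), sq_nonneg (|x| ^ n)]
    rw [Polynomial.eval_monomial, abs_mul, abs_pow, mul_assoc, Real.exp_neg]
    refine mul_le_mul_of_nonneg_left ?_ (abs_nonneg a)
    rw [← div_eq_mul_inv, div_le_iff₀ hexp]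
    linarith

/-- The Gaussian `e^{-y²/2}` as a real-valued Schwartz function. -/
def gaussianReal : 𝓢(ℝ, ℝ) where
  toFun y := Real.exp (-(y ^ 2 / 2))
  smooth' := by fun_prop
  decay' k n := by
    obtain ⟨C, hC⟩ := exists_bound_polynomial_mul_gaussian
      (Polynomial.X ^ k * (Polynomial.hermite n).map (Int.castRingHom ℝ))
    refine ⟨C, fun x => (le_of_eq ?_).trans (hC x)⟩
    rw [norm_iteratedFDeriv_eq_norm_iteratedDeriv, iteratedDeriv_eq_iterate,
      Polynomial.deriv_gaussian_eq_hermite_mul_gaussian]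
    simp [Polynomial.aeval_def, Polynomial.eval_map, abs_mul, mul_assoc]

/-- The Gaussian `e^{-y²/2}` as a complex-valued Schwartz function. -/
def gaussian : 𝓢(ℝ, ℂ) := gaussianReal.postcompCLM Complex.ofRealCLM

lemma gaussian_apply (y : ℝ) : gaussian y = ((Real.exp (-(y ^ 2 / 2)) : ℝ) : ℂ) := rfl

/-- Multiplication by the coordinate on Schwartz functions. -/
def position : 𝓢(ℝ, ℂ) →L[ℂ] 𝓢(ℝ, ℂ) :=
  SchwartzMap.smulLeftCLM ℂ (fun y : ℝ => (y : ℂ))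

lemma position_apply (f : 𝓢(ℝ, ℂ)) (y : ℝ) : position f y = y * f y := by
  have h : (fun y : ℝ => (y : ℂ)).HasTemperateGrowth := Complex.ofRealCLM.hasTemperateGrowth
  simp [position, SchwartzMap.smulLeftCLM_apply_apply h]

/-- Differentiation on Schwartz functions. -/
def derivative : 𝓢(ℝ, ℂ) →L[ℂ] 𝓢(ℝ, ℂ) := SchwartzMap.derivCLM ℂ ℂ

lemma derivative_apply (f : 𝓢(ℝ, ℂ)) (y : ℝ) : derivative f y = deriv f y := rfl

lemma derivative_position (f : 𝓢(ℝ, ℂ)) :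
    derivative (position f) = f + position (derivative f) := by
  ext y
  have h : (position f : ℝ → ℂ) = fun y : ℝ => (y : ℂ) * f y := funext (position_apply f)
  have hd := (Complex.ofRealCLM.hasDerivAt (x := y)).mul (f.differentiableAt (x := y)).hasDerivAt
  rw [derivative_apply, h, add_apply, position_apply, derivative_apply]
  exact hd.deriv.trans (by simp)

/-- The creation operator `y - d/dy` on Schwartz functions. -/
def raise (f : 𝓢(ℝ, ℂ)) : 𝓢(ℝ, ℂ) := position f - derivative f

/-- The annihilation operator `y + d/dy` on Schwartz functions. -/
def lower (f : 𝓢(ℝ, ℂ)) : 𝓢(ℝ, ℂ) := position f + derivative f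

/-- The harmonic oscillator `y² - d²/dy²` on Schwartz functions. -/
def oscillator (f : 𝓢(ℝ, ℂ)) : 𝓢(ℝ, ℂ) := position (position f) - derivative (derivative f)

lemma lower_raise (f : 𝓢(ℝ, ℂ)) : lower (raise f) = oscillator f + f := by
  simp only [lower, raise, oscillator, map_sub, derivative_position]
  abel

lemma raise_lower (f : 𝓢(ℝ, ℂ)) : raise (lower f) = oscillator f - f := by
  simp only [lower, raise, oscillator, map_add, derivative_position]
  abel

lemma smul_add_self (c : ℂ) (f : 𝓢(ℝ, ℂ)) : c • f + f = (c + 1) • f := by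
  rw [add_smul, one_smul]

lemma raise_smul (c : ℂ) (f : 𝓢(ℝ, ℂ)) : raise (c • f) = c • raise f := by
  simp only [raise, map_smul, smul_sub]

lemma coe_oscillator (f : 𝓢(ℝ, ℂ)) : (oscillator f : ℝ → ℂ) = Aop f := by
  funext y
  have h : (derivative f : ℝ → ℂ) = deriv f := rfl
  rw [oscillator, sub_apply, position_apply, position_apply, derivative_apply, h, Aop,
    iteratedDeriv_succ, iteratedDeriv_one]
  ring

lemma coe_oscillator_iterate (f : 𝓢(ℝ, ℂ)) (p : ℕ) :
    (oscillator^[p] f : ℝ → ℂ) = Aop^[p] f := by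
  induction p with
  | zero => rfl
  | succ p ih => rw [Function.iterate_succ_apply', Function.iterate_succ_apply', coe_oscillator, ih]

/-- The bilinear pairing `∫ f g` of two Schwartz functions. -/
def pairing (f g : 𝓢(ℝ, ℂ)) : ℂ := ∫ y : ℝ, f y * g y

lemma integrable_mul (f g : 𝓢(ℝ, ℂ)) : Integrable fun y : ℝ => f y * g y :=
  (SchwartzMap.smulLeftCLM ℂ f g).integrable.congr
    (.of_forall fun y => by simp [SchwartzMap.smulLeftCLM_apply_apply f.hasTemperateGrowth])

lemma pairing_comm (f g : 𝓢(ℝ, ℂ)) : pairing f g = pairing g f := by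
  simp only [pairing, mul_comm]

lemma pairing_add_right (f g h : 𝓢(ℝ, ℂ)) : pairing f (g + h) = pairing f g + pairing f h := by
  simp only [pairing, add_apply, mul_add]
  exact integral_add (integrable_mul f g) (integrable_mul f h)

lemma pairing_sub_right (f g h : 𝓢(ℝ, ℂ)) : pairing f (g - h) = pairing f g - pairing f h := by
  simp only [pairing, sub_apply, mul_sub]
  exact integral_sub (integrable_mul f g) (integrable_mul f h)

lemma pairing_smul_right (c : ℂ) (f g : 𝓢(ℝ, ℂ)) : pairing f (c • g) = c * pairing f g := by
  simp only [pairing, smul_apply, smul_eq_mul, mul_left_comm _ c]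
  exact integral_const_mul c _

lemma pairing_smul_left (c : ℂ) (f g : 𝓢(ℝ, ℂ)) : pairing (c • f) g = c * pairing f g := by
  rw [pairing_comm, pairing_smul_right, pairing_comm]

lemma pairing_position (f g : 𝓢(ℝ, ℂ)) : pairing (position f) g = pairing f (position g) := by
  simp only [pairing, position_apply]
  congr 1
  funext y
  ring

lemma pairing_derivative (f g : 𝓢(ℝ, ℂ)) :
    pairing (derivative f) g = -pairing f (derivative g) := by
  have h := SchwartzMap.integral_mul_deriv_eq_neg_deriv_mul f g
  simp only [pairing, derivative_apply, h, neg_neg]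

lemma pairing_raise (f g : 𝓢(ℝ, ℂ)) : pairing (raise f) g = pairing f (lower g) := by
  rw [pairing_comm, raise, lower, pairing_sub_right, pairing_add_right, pairing_comm g,
    pairing_comm g, pairing_position, pairing_derivative, sub_neg_eq_add]

lemma pairing_oscillator (f g : 𝓢(ℝ, ℂ)) :
    pairing (oscillator f) g = pairing f (oscillator g) := by
  rw [pairing_comm, oscillator, oscillator, pairing_sub_right, pairing_sub_right, pairing_comm g,
    pairing_comm g, pairing_position, pairing_position, pairing_derivative, pairing_derivative,
    neg_neg]

/-- The unnormalised Hermite functions `e^{-y²/2} H_k(y)`. -/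
def hermiteFun (k : ℕ) : 𝓢(ℝ, ℂ) := raise^[k] gaussian

lemma hermiteFun_succ (k : ℕ) : hermiteFun (k + 1) = raise (hermiteFun k) :=
  Function.iterate_succ_apply' _ _ _

lemma lower_gaussian : lower gaussian = 0 := by
  ext y
  have hg : (gaussian : ℝ → ℂ) = fun y => ((Real.exp (-(y ^ 2 / 2)) : ℝ) : ℂ) :=
    funext gaussian_apply
  have h : HasDerivAt (fun y : ℝ => Real.exp (-(y ^ 2 / 2)))
      (Real.exp (-(y ^ 2 / 2)) * -(2 * y / 2)) y := by
    simpa using (((hasDerivAt_pow 2 y).div_const 2).neg).exp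
  rw [lower, add_apply, position_apply, derivative_apply, hg, h.ofReal_comp.deriv]
  push_cast
  change _ = (0 : ℂ)
  ring

lemma oscillator_hermiteFun (k : ℕ) :
    oscillator (hermiteFun k) = (2 * k + 1 : ℂ) • hermiteFun k := by
  induction k with
  | zero =>
    have h := raise_lower gaussian
    rw [lower_gaussian, raise, map_zero, map_zero, sub_zero, eq_comm, sub_eq_zero] at h
    simpa [hermiteFun] using h
  | succ k ih =>
    have h := raise_lower (raise (hermiteFun k))
    rw [lower_raise, ih, ← hermiteFun_succ, eq_sub_iff_add_eq] at h
    rw [← h, smul_add_self, raise_smul, ← hermiteFun_succ,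
      smul_add_self]
    congr 1
    push_cast
    ring

lemma pairing_oscillator_iterate_hermiteFun (f : 𝓢(ℝ, ℂ)) (p k : ℕ) :
    pairing (oscillator^[p] f) (hermiteFun k) =
      (2 * k + 1 : ℂ) ^ p * pairing f (hermiteFun k) := by
  induction p with
  | zero => simp
  | succ p ih =>
    rw [Function.iterate_succ_apply', pairing_oscillator, oscillator_hermiteFun,
      pairing_smul_right, ih]
    ring

lemma pairing_hermiteFun_of_ne {j k : ℕ} (hjk : j ≠ k) :
    pairing (hermiteFun j) (hermiteFun k) = 0 := by
  have h := pairing_oscillator (hermiteFun j) (hermiteFun k)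
  rw [oscillator_hermiteFun, oscillator_hermiteFun, pairing_smul_left, pairing_smul_right] at h
  have hne : (2 * j + 1 : ℂ) - (2 * k + 1) ≠ 0 := by
    intro h0
    apply hjk
    have h1 : (j : ℂ) = k := by linear_combination h0 / 2
    exact_mod_cast h1
  refine (mul_eq_zero.mp ?_).resolve_left hne
  linear_combination h

lemma pairing_hermiteFun_self (k : ℕ) :
    pairing (hermiteFun k) (hermiteFun k) =
      (((2 : ℝ) ^ k * (Nat.factorial k : ℝ) * Real.sqrt Real.pi : ℝ) : ℂ) := by
  induction k with
  | zero =>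
    have h : (fun y : ℝ => gaussian y * gaussian y) =
        fun y : ℝ => ((Real.exp (-1 * y ^ 2) : ℝ) : ℂ) := by
      funext y
      rw [gaussian_apply, ← Complex.ofReal_mul, ← Real.exp_add]
      congr 2
      ring
    simp only [hermiteFun, Function.iterate_zero, id_eq, pairing, h]
    rw [integral_complex_ofReal, integral_gaussian]
    simp
  | succ k ih =>
    rw [hermiteFun_succ, pairing_raise, lower_raise, oscillator_hermiteFun,
      smul_add_self, pairing_smul_right, ih, Nat.factorial_succ]
    push_cast
    ring

/-- The normalisation constant of the Hermite functions. -/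
def normConst (k : ℕ) : ℝ :=
  ((2 : ℝ) ^ k * (Nat.factorial k : ℝ) * Real.sqrt Real.pi) ^ (-(1 : ℝ) / 2)

lemma normConst_mul_self (k : ℕ) :
    normConst k * normConst k * ((2 : ℝ) ^ k * (Nat.factorial k : ℝ) * Real.sqrt Real.pi) = 1 := by
  have h : 0 < (2 : ℝ) ^ k * (Nat.factorial k : ℝ) * Real.sqrt Real.pi := by positivity
  rw [normConst, ← Real.rpow_add h, show -(1 : ℝ) / 2 + -(1 : ℝ) / 2 = -1 by norm_num,
    Real.rpow_neg_one, inv_mul_cancel₀ h.ne']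

lemma hermiteFun_apply (k : ℕ) (y : ℝ) :
    hermiteFun k y = ((Real.exp (-y ^ 2 / 2) * Hpoly k y : ℝ) : ℂ) := by
  induction k generalizing y with
  | zero =>
    have h : Real.exp (-(y ^ 2 / 2)) =
        Real.exp (-y ^ 2 / 2) * (Real.exp (y ^ 2) * Real.exp (-y ^ 2)) := by
      rw [← Real.exp_add, ← Real.exp_add]
      congr 1
      ring
    simp only [hermiteFun, Function.iterate_zero, id_eq, gaussian_apply, Hpoly, iteratedDeriv_zero,
      pow_zero, one_mul, h]
  | succ k ih =>
    have hk : (hermiteFun k : ℝ → ℂ) =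
        fun y => ((Real.exp (-y ^ 2 / 2) * Hpoly k y : ℝ) : ℂ) := funext ih
    have hsmooth : ContDiff ℝ (k + 1 : ℕ) fun z : ℝ => Real.exp (-z ^ 2) := by fun_prop
    have h1 : HasDerivAt (iteratedDeriv k fun z : ℝ => Real.exp (-z ^ 2))
        (iteratedDeriv (k + 1) (fun z : ℝ => Real.exp (-z ^ 2)) y) y := by
      rw [iteratedDeriv_succ]
      exact (hsmooth.differentiable_iteratedDeriv k (by exact_mod_cast k.lt_succ_self) y).hasDerivAt
    have h2 : HasDerivAt (fun z : ℝ => Real.exp (-z ^ 2 / 2))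
        (Real.exp (-y ^ 2 / 2) * (-(2 * y) / 2)) y := by
      simpa using (((hasDerivAt_pow 2 y).neg).div_const 2).exp
    have h3 : HasDerivAt (fun z : ℝ => Real.exp (z ^ 2)) (Real.exp (y ^ 2) * (2 * y)) y := by
      simpa using (hasDerivAt_pow 2 y).exp
    have h4 : HasDerivAt (fun z : ℝ => Real.exp (-z ^ 2 / 2) * Hpoly k z) _ y :=
      h2.mul ((h3.const_mul ((-1) ^ k)).mul h1)
    rw [hermiteFun_succ, raise, sub_apply, position_apply, derivative_apply, hk,
      h4.ofReal_comp.deriv, ← Complex.ofReal_mul, ← Complex.ofReal_sub]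
    congr 1
    simp only [Hpoly]
    ring

/-- The Hermite functions as Schwartz functions. -/
def hermiteSchwartz (k : ℕ) : 𝓢(ℝ, ℂ) := (normConst k : ℂ) • hermiteFun k

lemma hermiteSchwartz_apply (k : ℕ) (y : ℝ) : hermiteSchwartz k y = ((Φh k y : ℝ) : ℂ) := by
  rw [hermiteSchwartz, smul_apply, hermiteFun_apply, smul_eq_mul,
    ← Complex.ofReal_mul, Φh, normConst,
    mul_assoc _ (Real.exp _)]

lemma inner_hermiteSchwartz (k : ℕ) (f : 𝓢(ℝ, ℂ)) :
    inner ℂ ((hermiteSchwartz k).toLp 2 (volume : Measure ℝ)) (f.toLp 2 volume) = pairing f (hermiteSchwartz k) := by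
  rw [SchwartzMap.inner_toL2_toL2_eq (μ := volume), pairing]
  congr 1
  funext y
  simp [hermiteSchwartz_apply, Complex.conj_ofReal]

lemma orthonormal_hermiteSchwartz :
    Orthonormal ℂ fun k : ℕ => (hermiteSchwartz k).toLp 2 (volume : Measure ℝ) := by
  rw [orthonormal_iff_ite]
  intro j k
  rw [inner_hermiteSchwartz, hermiteSchwartz, hermiteSchwartz, pairing_smul_left,
    pairing_smul_right]
  split_ifs with h
  · subst h
    rw [pairing_hermiteFun_self, ← mul_assoc]
    exact_mod_cast normConst_mul_self j
  · rw [pairing_hermiteFun_of_ne (Ne.symm h), mul_zero, mul_zero]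

lemma norm_toLp_sq (f : 𝓢(ℝ, ℂ)) : ‖f.toLp 2 (volume : Measure ℝ)‖ ^ 2 = ∫ y : ℝ, ‖f y‖ ^ 2 := by
  have h := inner_self_eq_norm_sq_to_K (𝕜 := ℂ) (f.toLp 2 (volume : Measure ℝ))
  rw [SchwartzMap.inner_toL2_toL2_eq (μ := volume)] at h
  simp only [inner_self_eq_norm_sq_to_K] at h
  have h' : (∫ y : ℝ, ((‖f y‖ ^ 2 : ℝ) : ℂ)) =
      ((‖f.toLp 2 (volume : Measure ℝ)‖ ^ 2 : ℝ) : ℂ) := by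
    push_cast
    exact h
  rw [integral_complex_ofReal] at h'
  exact_mod_cast h'.symm

lemma pairing_oscillator_iterate (f : 𝓢(ℝ, ℂ)) (p k : ℕ) :
    pairing (oscillator^[p] f) (hermiteSchwartz k) =
      (2 * k + 1 : ℂ) ^ p * pairing f (hermiteSchwartz k) := by
  rw [hermiteSchwartz, pairing_smul_right, pairing_smul_right,
    pairing_oscillator_iterate_hermiteFun, mul_left_comm]

lemma norm_pairing_sq_le (f : 𝓢(ℝ, ℂ)) (p : ℕ) {N k : ℕ} (hk : N < k) :
    ‖pairing f (hermiteSchwartz k)‖ ^ 2 ≤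
      ((2 * (N : ℝ) + 3) ^ (2 * p))⁻¹ * ‖pairing (oscillator^[p] f) (hermiteSchwartz k)‖ ^ 2 := by
  have hN : (0 : ℝ) < 2 * N + 3 := by positivity
  have hNk : (2 * N + 3 : ℝ) ≤ 2 * k + 1 := by
    have h : (N + 1 : ℝ) ≤ k := by exact_mod_cast hk
    linarith
  have hnorm : ‖(2 * k + 1 : ℂ)‖ = 2 * k + 1 := by
    have h : (2 * k + 1 : ℂ) = ((2 * k + 1 : ℕ) : ℂ) := by push_cast; rfl
    rw [h, Complex.norm_natCast]
    push_cast
    rfl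
  rw [pairing_oscillator_iterate, norm_mul, norm_pow, hnorm, mul_pow, ← pow_mul, mul_comm p 2,
    ← mul_assoc]
  refine le_mul_of_one_le_left (by positivity) ?_
  rw [inv_mul_eq_div, one_le_div (by positivity)]
  gcongr

lemma tsum_norm_pairing_sq_le (f : 𝓢(ℝ, ℂ)) (p N : ℕ) :
    ∑' k : {k : ℕ // N < k}, ‖pairing f (hermiteSchwartz k)‖ ^ 2 ≤
      ((2 * (N : ℝ) + 3) ^ (2 * p))⁻¹ * ∫ y : ℝ, ‖oscillator^[p] f y‖ ^ 2 := by
  set g := oscillator^[p] f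
  have hsum : Summable fun k : ℕ => ‖pairing g (hermiteSchwartz k)‖ ^ 2 := by
    have h := orthonormal_hermiteSchwartz.inner_products_summable (x := g.toLp 2 volume)
    simpa only [inner_hermiteSchwartz] using h
  have hbessel : ∑' k : ℕ, ‖pairing g (hermiteSchwartz k)‖ ^ 2 ≤ ∫ y : ℝ, ‖g y‖ ^ 2 := by
    have h := orthonormal_hermiteSchwartz.tsum_inner_products_le (x := g.toLp 2 volume)
    simpa only [inner_hermiteSchwartz, norm_toLp_sq] using h
  have hsub : Summable fun k : {k : ℕ // N < k} => ‖pairing g (hermiteSchwartz k)‖ ^ 2 :=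
    hsum.subtype {k | N < k}
  have hle : ∀ k : {k : ℕ // N < k}, ‖pairing f (hermiteSchwartz k)‖ ^ 2 ≤
      ((2 * (N : ℝ) + 3) ^ (2 * p))⁻¹ * ‖pairing g (hermiteSchwartz k)‖ ^ 2 :=
    fun k => norm_pairing_sq_le f p k.2
  calc ∑' k : {k : ℕ // N < k}, ‖pairing f (hermiteSchwartz k)‖ ^ 2
      ≤ ∑' k : {k : ℕ // N < k},
          ((2 * (N : ℝ) + 3) ^ (2 * p))⁻¹ * ‖pairing g (hermiteSchwartz k)‖ ^ 2 :=
        ((hsub.mul_left _).of_nonneg_of_le (fun _ => by positivity) hle).tsum_le_tsum hle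
          (hsub.mul_left _)
    _ = ((2 * (N : ℝ) + 3) ^ (2 * p))⁻¹ *
          ∑' k : {k : ℕ // N < k}, ‖pairing g (hermiteSchwartz k)‖ ^ 2 := tsum_mul_left
    _ ≤ ((2 * (N : ℝ) + 3) ^ (2 * p))⁻¹ * ∫ y : ℝ, ‖g y‖ ^ 2 := by
        refine mul_le_mul_of_nonneg_left ?_ (by positivity)
        exact (Summable.tsum_subtype_le (fun k : ℕ => ‖pairing g (hermiteSchwartz k)‖ ^ 2) {k | N < k}
          (fun _ => by positivity) hsum).trans hbessel

end HermiteTail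

/-- Hermite tail estimate (essence of Lemma 2.1). -/
theorem hermite_tail_estimate (G : ℝ → ℂ) (hG : IsSchwartz1 G) (p N : ℕ) :
    ∑' k : {k : ℕ // N < k}, ‖∫ y : ℝ, G y * ((Φh (k : ℕ) y : ℝ) : ℂ)‖^2 ≤
      ((2*(N:ℝ)+3) ^ (2*p))⁻¹ * ∫ y : ℝ, ‖(Aop^[p] G) y‖^2 := by
  let f : 𝓢(ℝ, ℂ) :=
    { toFun := G
      smooth' := hG.1
      decay' := fun k n => by
        simpa only [norm_iteratedFDeriv_eq_norm_iteratedDeriv, Real.norm_eq_abs] using hG.2 k n }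
  have hf : (f : ℝ → ℂ) = G := rfl
  have h := HermiteTail.tsum_norm_pairing_sq_le f p N
  simpa only [HermiteTail.pairing, HermiteTail.hermiteSchwartz_apply,
    HermiteTail.coe_oscillator_iterate, hf] using h

end
end

section
/- Vanishing of the even matrix elements of the quantum correction: let V : ℝ → ℝ be differentiable with V and V' of at most polynomial growth, let ħ > 0, and let k, l ∈ ℕ with k + l even. Then for every x ∈ ℝ, ℰ^ħ_{k,l}(x) := ∫_ℝ ℰ^ħ(x,y) Φ_k(y) Φ_l(y) dy = 0, where ℰ^ħ(x,y) = (V(x + ħy/2) − V(x − ħy/2))/ħ − V'(x)·y. -/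
open MeasureTheory

noncomputable section

lemma Hpoly_neg (k : ℕ) (y : ℝ) : Hpoly k (-y) = (-1) ^ k * Hpoly k y := by
  have h := iteratedDeriv_comp_neg k (fun z : ℝ => Real.exp (-z ^ 2)) y
  simp only [neg_sq, smul_eq_mul] at h
  have hs : ((-1 : ℝ) ^ k) * (-1) ^ k = 1 := by rw [← mul_pow]; simp
  have h' : iteratedDeriv k (fun z : ℝ => Real.exp (-z ^ 2)) (-y) =
      (-1) ^ k * iteratedDeriv k (fun z : ℝ => Real.exp (-z ^ 2)) y := by
    rw [h, ← mul_assoc, hs, one_mul]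
  rw [Hpoly, Hpoly, h', neg_sq]
  ring

lemma Φh_neg (k : ℕ) (y : ℝ) : Φh k (-y) = (-1) ^ k * Φh k y := by
  rw [Φh, Φh, Hpoly_neg, neg_sq]
  ring

lemma Eh_neg (hbar : ℝ) (V : ℝ → ℝ) (x y : ℝ) : Eh hbar V x (-y) = -Eh hbar V x y := by
  have h₁ : x + hbar * -y / 2 = x - hbar * y / 2 := by ring
  have h₂ : x - hbar * -y / 2 = x + hbar * y / 2 := by ring
  rw [Eh, Eh, h₁, h₂]
  ring

/-- Vanishing of the even matrix elements of the quantum correction. -/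
theorem quantum_correction_even_matrix_elements_vanish (V : ℝ → ℝ)
    (hV : Differentiable ℝ V)
    (hVgrow : ∃ (C : ℝ) (n : ℕ), ∀ x : ℝ, |V x| ≤ C * (1 + |x|)^n)
    (hV'grow : ∃ (C : ℝ) (n : ℕ), ∀ x : ℝ, |deriv V x| ≤ C * (1 + |x|)^n)
    (hbar : ℝ) (hh : 0 < hbar) (k l : ℕ) (hkl : Even (k + l)) :
    ∀ x : ℝ, Ekl hbar V k l x = 0 := by
  intro x
  have h := integral_neg_eq_self (fun y : ℝ => Eh hbar V x y * Φh k y * Φh l y) volume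
  have h_odd : ∀ y : ℝ, Eh hbar V x (-y) * Φh k (-y) * Φh l (-y) =
      -(Eh hbar V x y * Φh k y * Φh l y) := fun y => by
    have hs : ((-1 : ℝ) ^ k) * (-1) ^ l = 1 := by rw [← pow_add, hkl.neg_one_pow]
    rw [Eh_neg, Φh_neg, Φh_neg]
    linear_combination (-(Eh hbar V x y * Φh k y * Φh l y)) * hs
  simp only [h_odd, integral_neg] at h
  rw [Ekl]
  linarith

end
end

section
/- L² conservation for the semiclassical Hermite–Galerkin system (Proposition 3.2 (ii)): let V : ℝ → ℝ be smooth with all derivatives of order ≥ 2 bounded, let N ∈ ℕ, and let (R_k)_{k=0}^N be a strong solution of the semiclassical Hermite–Galerkin system of size N. Then for every t ≥ 0, Σ_{k=0}^N ‖R_k(t,·)‖²_{L²(ℝ)} = Σ_{k=0}^N ‖R_k(0,·)‖²_{L²(ℝ)}. -/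
open MeasureTheory

noncomputable section

namespace IsSchwartz1

variable {u : ℝ → ℂ}

lemma zero : IsSchwartz1 (fun _ => 0) := by
  refine ⟨contDiff_const, fun k n => ⟨0, fun x => ?_⟩⟩
  simp

lemma integrable (hu : IsSchwartz1 u) : Integrable u := by
  refine SchwartzMap.integrable (⟨u, hu.1, fun k n => ?_⟩ : SchwartzMap ℝ ℂ)
  obtain ⟨C, hC⟩ := hu.2 k n
  exact ⟨C, fun x => by simpa [norm_iteratedFDeriv_eq_norm_iteratedDeriv] using hC x⟩

lemma differentiable (hu : IsSchwartz1 u) : Differentiable ℝ u :=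
  hu.1.differentiable (by simp)

lemma continuous_deriv (hu : IsSchwartz1 u) : Continuous (deriv u) :=
  hu.1.continuous_deriv (by simp)

lemma integrable_conj (hu : IsSchwartz1 u) : Integrable (fun x => star (u x)) :=
  hu.integrable.mono hu.1.continuous.star.aestronglyMeasurable (by simp)

lemma exists_norm_le (hu : IsSchwartz1 u) : ∃ C, ∀ x, ‖u x‖ ≤ C := by
  simpa using hu.2 0 0

lemma exists_norm_deriv_le (hu : IsSchwartz1 u) : ∃ C, ∀ x, ‖deriv u x‖ ≤ C := by
  simpa using hu.2 0 1

end IsSchwartz1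

/-- The derivative of an admissible potential grows at most linearly. -/
lemma SmoothBounded.exists_abs_deriv_le {V : ℝ → ℝ} (hV : SmoothBounded V) :
    ∃ C, ∀ x, |deriv V x| ≤ |deriv V 0| + C * |x| := by
  obtain ⟨C, hC⟩ := hV.2 2 le_rfl
  have hd : Differentiable ℝ (deriv V) := by
    have := hV.1.differentiable_iteratedDeriv 1 (by exact_mod_cast WithTop.coe_lt_top 1)
    rwa [iteratedDeriv_one] at this
  refine ⟨C, fun x => ?_⟩
  have h := Convex.norm_image_sub_le_of_norm_deriv_le (f := deriv V) (x := 0) (y := x) (C := C)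
    (fun y _ => hd y) (fun y _ => ?_) convex_univ trivial trivial
  · simp only [Real.norm_eq_abs, sub_zero] at h
    linarith [abs_sub_abs_le_abs_sub (deriv V x) (deriv V 0)]
  · simpa [iteratedDeriv_succ] using hC y

lemma SmoothBounded.continuous_deriv {V : ℝ → ℝ} (hV : SmoothBounded V) :
    Continuous (deriv V) :=
  hV.1.continuous_deriv (by simp)

lemma IsSchwartz1.exists_norm_deriv_potential_mul_le {V : ℝ → ℝ} (hV : SmoothBounded V)
    {u : ℝ → ℂ} (hu : IsSchwartz1 u) : ∃ C, ∀ x, ‖((deriv V x : ℝ) : ℂ) * u x‖ ≤ C := by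
  obtain ⟨A, hA⟩ := hV.exists_abs_deriv_le
  obtain ⟨B, hB⟩ := hu.exists_norm_le
  obtain ⟨B', hB'⟩ := hu.2 1 0
  refine ⟨|deriv V 0| * B + |A| * B', fun x => ?_⟩
  have h1 : |x| * ‖u x‖ ≤ B' := by simpa using hB' x
  calc ‖((deriv V x : ℝ) : ℂ) * u x‖ = |deriv V x| * ‖u x‖ := by simp
    _ ≤ (|deriv V 0| + |A| * |x|) * ‖u x‖ := by
      gcongr
      exact (hA x).trans (by gcongr; exact le_abs_self A)
    _ = |deriv V 0| * ‖u x‖ + |A| * (|x| * ‖u x‖) := by ring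
    _ ≤ _ := by gcongr; exact hB x

lemma IsSchwartz1.integrable_conj_mul_Dop {V : ℝ → ℝ} (hV : SmoothBounded V) {u v : ℝ → ℂ}
    (hu : IsSchwartz1 u) (hv : IsSchwartz1 v) :
    Integrable (fun x => star (u x) * Dop V v x) := by
  obtain ⟨A, hA⟩ := hv.exists_norm_deriv_le
  obtain ⟨B, hB⟩ := hv.exists_norm_deriv_potential_mul_le hV
  refine hu.integrable_conj.mul_bdd (c := A + B) ?_ (ae_of_all _ fun x => ?_)
  · exact (hv.continuous_deriv.add ((Complex.continuous_ofReal.comp hV.continuous_deriv).mul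
      hv.1.continuous)).aestronglyMeasurable
  · exact (norm_add_le _ _).trans (add_le_add (hA x) (hB x))

lemma IsSchwartz1.integrable_conj_mul_Dstar {V : ℝ → ℝ} (hV : SmoothBounded V) {u v : ℝ → ℂ}
    (hu : IsSchwartz1 u) (hv : IsSchwartz1 v) :
    Integrable (fun x => star (u x) * Dstar V v x) := by
  obtain ⟨A, hA⟩ := hv.exists_norm_deriv_le
  obtain ⟨B, hB⟩ := hv.exists_norm_deriv_potential_mul_le hV
  refine hu.integrable_conj.mul_bdd (c := A + B) ?_ (ae_of_all _ fun x => ?_)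
  · exact (hv.continuous_deriv.neg.add ((Complex.continuous_ofReal.comp hV.continuous_deriv).mul
      hv.1.continuous)).aestronglyMeasurable
  · exact (norm_add_le _ _).trans (add_le_add (by simpa using hA x) (hB x))

/-- `𝒟` and `𝒟*` are formally adjoint on Schwartz functions (imaginary part). -/
lemma IsSchwartz1.integral_im_conj_mul_Dstar {V : ℝ → ℝ} (hV : SmoothBounded V) {u v : ℝ → ℂ}
    (hu : IsSchwartz1 u) (hv : IsSchwartz1 v) :
    ∫ x, (star (v x) * Dstar V u x).im = -∫ x, (star (u x) * Dop V v x).im := by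
  have hD := hu.integrable_conj_mul_Dop hV hv
  have hS := hv.integrable_conj_mul_Dstar hV hu
  have hder : ∀ x, HasDerivAt (fun x => star (u x) * v x)
      (star (u x) * Dop V v x - star (star (v x) * Dstar V u x)) x := fun x => by
    refine ((hu.differentiable x).hasDerivAt.star.mul
      (hv.differentiable x).hasDerivAt).congr_deriv ?_
    simp [Dop, Dstar]
    ring
  obtain ⟨C, hC⟩ := hv.exists_norm_le
  have hSc : Integrable (fun x => star (star (v x) * Dstar V u x)) :=
    hS.mono hS.1.star (by simp)
  have h0 := integral_eq_zero_of_hasDerivAt_of_integrable hder (hD.sub hSc)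
    (hu.integrable_conj.mul_bdd hv.1.continuous.aestronglyMeasurable (ae_of_all _ hC))
  have h1 : ∫ x, (star (u x) * Dop V v x - star (star (v x) * Dstar V u x)).im = 0 := by
    have := integral_im (hD.sub hSc)
    simp only [Pi.sub_apply, h0] at this
    simpa using this
  have h2 : ∫ x, ((star (u x) * Dop V v x).im + (star (v x) * Dstar V u x).im) = 0 := by
    rw [← h1]
    congr 1
    ext x
    rw [Complex.sub_im, Complex.star_def, Complex.conj_im, sub_neg_eq_add]
  have hDi : Integrable (fun x => (star (u x) * Dop V v x).im) := hD.im
  have hSi : Integrable (fun x => (star (v x) * Dstar V u x).im) := hS.im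
  rw [integral_add hDi hSi] at h2
  exact (neg_eq_of_add_eq_zero_right h2).symm

/-- The `L²` norm of a map `C¹` into `L²` has the expected right derivative of its square. -/
lemma C1intoL2one.hasDerivWithinAt_L2one_sq {u : ℝ → ℝ → ℂ} (hu : C1intoL2one u) {t : ℝ}
    (ht : 0 ≤ t) :
    HasDerivWithinAt (fun s => (L2one (u s)) ^ 2)
      (2 * ∫ x, (star (u t x) * deriv (fun s => u s x) t).re) (Set.Ici 0) t := by
  obtain ⟨Ψ, Ψ', h, h', hd, -⟩ := hu
  have hnorm : ∀ s, 0 ≤ s → (L2one (u s)) ^ 2 = ‖Ψ s‖ ^ 2 := fun s hs => by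
    rw [Lp.norm_def, L2one, eLpNorm_congr_ae (h s hs)]
  have hsq := (hd t ht).norm_sq
  rw [L2.inner_def] at hsq
  refine (hsq.congr (fun s hs => hnorm s hs) (hnorm t ht)).congr_deriv ?_
  congr 1
  refine integral_congr_ae ?_
  filter_upwards [h t ht, h' t ht] with x hx hx'
  rw [hx, hx', Complex.inner, mul_comm, Complex.star_def]

/-- `L²` conservation for the semiclassical Hermite–Galerkin system
(Proposition 3.2 (ii)). -/
theorem semiclassical_galerkin_L2_conservation (V : ℝ → ℝ) (hV : SmoothBounded V)
    (N : ℕ) (R : ℕ → ℝ → ℝ → ℂ) (hR : IsSCGalerkinSol V N R) :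
    ∀ t : ℝ, 0 ≤ t →
      ∑ k ∈ Finset.range (N+1), (L2one (R k t))^2 =
        ∑ k ∈ Finset.range (N+1), (L2one (R k 0))^2 := by
  obtain ⟨⟨-, hS, hC, hz⟩, heq⟩ := hR
  have hS' : ∀ k t, 0 ≤ t → IsSchwartz1 (R k t) := fun k t ht => by
    rcases le_or_gt k N with hk | hk
    · exact hS k hk t ht
    · rw [show R k t = fun _ => 0 from funext (hz k hk t)]
      exact IsSchwartz1.zero
  have hderiv : ∀ t, 0 ≤ t → HasDerivWithinAt
      (fun s => ∑ k ∈ Finset.range (N+1), (L2one (R k s))^2) 0 (Set.Ici 0) t := fun t ht => by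
    let p : ℕ → ℝ := fun k =>
      Real.sqrt ((k : ℝ)/2) * ∫ x, (star (R k t x) * Dop V (R (k-1) t) x).im
    have hterm : ∀ k ∈ Finset.range (N+1),
        ∫ x, (star (R k t x) * deriv (fun s => R k s x) t).re = p k - p (k+1) := fun k hk => by
      have hD : Integrable (fun x => (star (R k t x) * Dop V (R (k-1) t) x).im) :=
        ((hS' k t ht).integrable_conj_mul_Dop hV (hS' (k-1) t ht)).im
      have hDs : Integrable (fun x => (star (R k t x) * Dstar V (R (k+1) t) x).im) :=
        ((hS' k t ht).integrable_conj_mul_Dstar hV (hS' (k+1) t ht)).im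
      have hpt : ∀ x, (star (R k t x) * deriv (fun s => R k s x) t).re =
          Real.sqrt ((k : ℝ)/2) * (star (R k t x) * Dop V (R (k-1) t) x).im +
          Real.sqrt (((k : ℝ)+1)/2) * (star (R k t x) * Dstar V (R (k+1) t) x).im := fun x => by
        rw [eq_neg_of_add_eq_zero_left (heq k (Finset.mem_range_succ_iff.mp hk) t ht x)]
        simp
        ring
      simp_rw [hpt]
      rw [integral_add (hD.const_mul _) (hDs.const_mul _), integral_const_mul,
        integral_const_mul, (hS' (k+1) t ht).integral_im_conj_mul_Dstar hV (hS' k t ht)]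
      simp only [p, Nat.add_sub_cancel]
      push_cast
      ring
    have hsum := HasDerivWithinAt.fun_sum (u := Finset.range (N+1)) fun k hk =>
      (hC k (Finset.mem_range_succ_iff.mp hk)).hasDerivWithinAt_L2one_sq ht
    refine hsum.congr_deriv ?_
    rw [← Finset.mul_sum, Finset.sum_congr rfl hterm, Finset.sum_range_sub']
    simp [p, hz (N+1) (Nat.lt_succ_self N)]
  intro t ht
  exact constant_of_has_deriv_right_zero
    (fun s hs => (hderiv s hs.1).continuousWithinAt.mono Set.Icc_subset_Ici_self)
    (fun s hs => (hderiv s hs.1).mono (Set.Ici_subset_Ici.mpr hs.1)) t ⟨ht, le_rfl⟩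

end
end

section
/- L² conservation for the von Neumann Hermite–Galerkin system (Proposition 4.2 (ii)): let V : ℝ → ℝ be smooth with all derivatives of order ≥ 2 bounded, let ħ > 0 and N ∈ ℕ, and let (R_k)_{k=0}^N be a strong solution of the von Neumann Hermite–Galerkin system of size N. Then for every t ≥ 0, Σ_{k=0}^N ‖R_k(t,·)‖²_{L²(ℝ)} = Σ_{k=0}^N ‖R_k(0,·)‖²_{L²(ℝ)}. -/
open MeasureTheory

noncomputable section

/-- A function satisfying `IsSchwartz1`, bundled as a Schwartz map. -/
def IsSchwartz1.toSchwartzMap {f : ℝ → ℂ} (hf : IsSchwartz1 f) : SchwartzMap ℝ ℂ where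
  toFun := f
  smooth' := hf.1
  decay' k n := by
    obtain ⟨C, hC⟩ := hf.2 k n
    refine ⟨C, fun x => ?_⟩
    rw [norm_iteratedFDeriv_eq_norm_iteratedDeriv]
    exact hC x

theorem IsSchwartz1.hasDerivAt {f : ℝ → ℂ} (hf : IsSchwartz1 f) (x : ℝ) :
    HasDerivAt f (deriv f x) x :=
  (hf.1.differentiable (by simp)).differentiableAt.hasDerivAt

theorem IsSchwartz1.memLp {f : ℝ → ℂ} (hf : IsSchwartz1 f) : MemLp f 2 volume :=
  hf.toSchwartzMap.memLp 2 volume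

theorem IsSchwartz1.memLp_deriv {f : ℝ → ℂ} (hf : IsSchwartz1 f) :
    MemLp (deriv f) 2 volume :=
  (SchwartzMap.derivCLM ℝ ℂ hf.toSchwartzMap).memLp 2 volume

theorem isSchwartz1_zero : IsSchwartz1 (fun _ => 0) :=
  ⟨contDiff_const, fun k n => ⟨0, fun x => by
    rw [iteratedDeriv_const]; simp⟩⟩

theorem MeasureTheory.MemLp.integrable_real_inner {f g : ℝ → ℂ} (hf : MemLp f 2 volume)
    (hg : MemLp g 2 volume) : Integrable (fun x => inner ℝ (f x) (g x)) := by
  refine (L2.integrable_inner (𝕜 := ℝ) (hf.toLp f) (hg.toLp g)).congr ?_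
  filter_upwards [hf.coeFn_toLp, hg.coeFn_toLp] with x h1 h2
  rw [h1, h2]

/-- The flux `Im (conj f · g)` of two Schwartz functions has an `x`-derivative of mean zero. -/
theorem IsSchwartz1.integrable_and_integral_deriv_flux {f g : ℝ → ℂ} (hf : IsSchwartz1 f)
    (hg : IsSchwartz1 g) :
    Integrable (fun x => inner ℝ (Complex.I * f x) (deriv g x) +
        inner ℝ (Complex.I * deriv f x) (g x)) ∧
      ∫ x, (inner ℝ (Complex.I * f x) (deriv g x) +
        inner ℝ (Complex.I * deriv f x) (g x)) = 0 := by
  have hint := ((hf.memLp.const_mul Complex.I).integrable_real_inner hg.memLp_deriv).add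
    ((hf.memLp_deriv.const_mul Complex.I).integrable_real_inner hg.memLp)
  refine ⟨hint, integral_eq_zero_of_hasDerivAt_of_integrable
    (fun x => ((hf.hasDerivAt x).const_mul Complex.I).inner ℝ (hg.hasDerivAt x)) hint
    ((hf.memLp.const_mul Complex.I).integrable_real_inner hg.memLp)⟩

/-- A real symmetric matrix contributes nothing to the imaginary part of its quadratic form. -/
theorem sum_inner_symm_matrix_eq_zero (n : ℕ) (u : ℕ → ℂ) (E : ℕ → ℕ → ℝ)
    (hE : ∀ k l, E k l = E l k) :
    ∑ k ∈ Finset.range n,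
      inner ℝ (u k) (-Complex.I * ∑ l ∈ Finset.range n, (E k l : ℂ) * u l) = 0 := by
  have h1 : ∀ k, inner ℝ (u k) (-Complex.I * ∑ l ∈ Finset.range n, (E k l : ℂ) * u l) =
      ∑ l ∈ Finset.range n, E k l * ((u k).re * (u l).im - (u k).im * (u l).re) := by
    intro k
    rw [Finset.mul_sum, inner_sum]
    refine Finset.sum_congr rfl fun l _ => ?_
    simp [Complex.inner]
    ring
  simp_rw [h1]
  have h2 := Finset.sum_comm (s := Finset.range n) (t := Finset.range n)
    (f := fun k l => E k l * ((u k).re * (u l).im - (u k).im * (u l).re))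
  have h3 : ∑ l ∈ Finset.range n, ∑ k ∈ Finset.range n,
      E k l * ((u k).re * (u l).im - (u k).im * (u l).re) =
      -∑ l ∈ Finset.range n, ∑ k ∈ Finset.range n,
      E l k * ((u l).re * (u k).im - (u l).im * (u k).re) := by
    simp_rw [← Finset.sum_neg_distrib]
    refine Finset.sum_congr rfl fun l _ => Finset.sum_congr rfl fun k _ => ?_
    rw [hE k l]
    ring
  linarith

/-- The transport part of the Galerkin system is in divergence form when tested against the
solution. -/
theorem sum_inner_transport_eq (n : ℕ) (u d : ℕ → ℂ) (v : ℝ) (a : ℕ → ℝ) (ha : a 0 = 0)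
    (hu : u n = 0) :
    ∑ k ∈ Finset.range n, inner ℝ (u k) (-Complex.I * ((a k : ℂ) * (d (k - 1) + v * u (k - 1)) +
        (a (k + 1) : ℂ) * (-d (k + 1) + v * u (k + 1)))) =
      ∑ k ∈ Finset.range n, a (k + 1) * (inner ℝ (Complex.I * u (k + 1)) (d k) +
        inner ℝ (Complex.I * d (k + 1)) (u k)) := by
  set T : ℕ → ℝ := fun k =>
    inner ℝ (u k) (-Complex.I * ((a k : ℂ) * (d (k - 1) + v * u (k - 1)))) with hT
  have hshift : ∑ k ∈ Finset.range n, T k = ∑ k ∈ Finset.range n, T (k + 1) := by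
    have h := (Finset.sum_range_succ T n).symm.trans (Finset.sum_range_succ' T n)
    have h0 : T 0 = 0 := by simp [hT, ha]
    have hn : T n = 0 := by simp [hT, hu]
    linarith
  simp_rw [mul_add (-Complex.I), inner_add_right, Finset.sum_add_distrib]
  change ∑ k ∈ Finset.range n, T k + _ = _
  rw [hshift, ← Finset.sum_add_distrib]
  refine Finset.sum_congr rfl fun k _ => ?_
  simp [hT, Complex.inner]
  ring

theorem Ekl_comm (hbar : ℝ) (V : ℝ → ℝ) (k l : ℕ) (x : ℝ) :
    Ekl hbar V k l x = Ekl hbar V l k x := by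
  simp only [Ekl, mul_right_comm]

/-- The `L²` energy balance of the Galerkin system at a fixed time. -/
theorem IsVNGalerkinSol.integral_sum_inner_eq_zero {V : ℝ → ℝ} {hbar : ℝ} {N : ℕ}
    {R : ℕ → ℝ → ℝ → ℂ} (hR : IsVNGalerkinSol hbar V N R) {t : ℝ} (ht : 0 ≤ t) :
    ∫ x, ∑ k ∈ Finset.range (N + 1), inner ℝ (R k t x) (deriv (fun s => R k s x) t) = 0 := by
  obtain ⟨⟨-, hS, -, hzero⟩, heq⟩ := hR
  have hS' : ∀ k, IsSchwartz1 (R k t) := fun k => by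
    rcases le_or_gt k N with hk | hk
    · exact hS k hk t ht
    · rw [show R k t = fun _ => 0 from funext (hzero k hk t)]
      exact isSchwartz1_zero
  have hpt : ∀ x, ∑ k ∈ Finset.range (N + 1),
      inner ℝ (R k t x) (deriv (fun s => R k s x) t) =
      ∑ k ∈ Finset.range (N + 1), Real.sqrt (((k : ℝ) + 1) / 2) *
        (inner ℝ (Complex.I * R (k + 1) t x) (deriv (R k t) x) +
          inner ℝ (Complex.I * deriv (R (k + 1) t) x) (R k t x)) := by
    intro x
    have h1 := sum_inner_transport_eq (N + 1) (fun k => R k t x) (fun k => deriv (R k t) x)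
      (deriv V x) (fun k => Real.sqrt ((k : ℝ) / 2)) (by simp) (hzero _ (Nat.lt_succ_self N) t x)
    have h2 := sum_inner_symm_matrix_eq_zero (N + 1) (fun k => R k t x)
      (fun k l => Ekl hbar V k l x) (fun k l => Ekl_comm hbar V k l x)
    push_cast at h1
    refine Eq.trans ?_ ((congrArg₂ (· + ·) h1 h2).trans (add_zero _))
    rw [← Finset.sum_add_distrib]
    refine Finset.sum_congr rfl fun k hk => ?_
    rw [← inner_add_right]
    congr 1
    have h := heq k (Nat.lt_succ_iff.mp (Finset.mem_range.mp hk)) t ht x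
    simp only [Dop, Dstar] at h
    linear_combination h
  simp_rw [hpt]
  have hflux := fun k => (hS' (k + 1)).integrable_and_integral_deriv_flux (hS' k)
  rw [integral_finsetSum _ fun k _ => (hflux k).1.const_mul _]
  refine Finset.sum_eq_zero fun k _ => ?_
  rw [integral_const_mul, (hflux k).2, mul_zero]

/-- `L²` conservation for the von Neumann Hermite–Galerkin system
(Proposition 4.2 (ii)). -/
theorem vonNeumann_galerkin_L2_conservation (V : ℝ → ℝ) (hV : SmoothBounded V)
    (hbar : ℝ) (hh : 0 < hbar) (N : ℕ) (R : ℕ → ℝ → ℝ → ℂ)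
    (hR : IsVNGalerkinSol hbar V N R) :
    ∀ t : ℝ, 0 ≤ t →
      ∑ k ∈ Finset.range (N+1), (L2one (R k t))^2 =
        ∑ k ∈ Finset.range (N+1), (L2one (R k 0))^2 := by
  have hC : ∀ k, ∃ Ψ Ψ' : ℝ → Lp ℂ 2 (volume : Measure ℝ), k ≤ N →
      (∀ t : ℝ, 0 ≤ t → (Ψ t : ℝ → ℂ) =ᵐ[volume] R k t) ∧
      (∀ t : ℝ, 0 ≤ t → (Ψ' t : ℝ → ℂ) =ᵐ[volume] fun x => deriv (fun s => R k s x) t) ∧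
      (∀ t : ℝ, 0 ≤ t → HasDerivWithinAt Ψ (Ψ' t) (Set.Ici 0) t) := by
    intro k
    by_cases hk : k ≤ N
    · obtain ⟨Ψ, Ψ', h1, h2, h3, -⟩ := hR.1.2.2.1 k hk
      exact ⟨Ψ, Ψ', fun _ => ⟨h1, h2, h3⟩⟩
    · exact ⟨0, 0, fun h => absurd h hk⟩
  choose Ψ Ψ' hΨ using hC
  have hle : ∀ {k}, k ∈ Finset.range (N + 1) → k ≤ N := fun hk =>
    Nat.lt_succ_iff.mp (Finset.mem_range.mp hk)
  have hnorm : ∀ t, 0 ≤ t → ∑ k ∈ Finset.range (N + 1), (L2one (R k t)) ^ 2 =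
      ∑ k ∈ Finset.range (N + 1), ‖Ψ k t‖ ^ 2 := fun t ht =>
    Finset.sum_congr rfl fun k hk => by
      rw [L2one, Lp.norm_def, eLpNorm_congr_ae ((hΨ k (hle hk)).1 t ht)]
  have henergy : ∀ t, 0 ≤ t →
      ∑ k ∈ Finset.range (N + 1), 2 * inner ℝ (Ψ k t) (Ψ' k t) = 0 := by
    intro t ht
    rw [← Finset.mul_sum]
    simp_rw [L2.inner_def]
    rw [← integral_finsetSum _ fun k _ => L2.integrable_inner (𝕜 := ℝ) (Ψ k t) (Ψ' k t),
      mul_eq_zero_of_right]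
    rw [← hR.integral_sum_inner_eq_zero ht]
    refine integral_congr_ae ?_
    have hae : ∀ᵐ x, ∀ k ∈ Finset.range (N + 1),
        Ψ k t x = R k t x ∧ Ψ' k t x = deriv (fun s => R k s x) t := by
      rw [Filter.eventually_all_finset]
      intro k hk
      exact ((hΨ k (hle hk)).1 t ht).and ((hΨ k (hle hk)).2.1 t ht)
    filter_upwards [hae] with x hx
    exact Finset.sum_congr rfl fun k hk => by rw [(hx k hk).1, (hx k hk).2]
  have hderiv : ∀ t, 0 ≤ t → HasDerivWithinAt
      (fun s => ∑ k ∈ Finset.range (N + 1), ‖Ψ k s‖ ^ 2) 0 (Set.Ici 0) t := by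
    intro t ht
    have h := HasDerivWithinAt.fun_sum fun k (hk : k ∈ Finset.range (N + 1)) =>
      ((hΨ k (hle hk)).2.2 t ht).norm_sq
    rwa [henergy t ht] at h
  intro t ht
  rw [hnorm t ht, hnorm 0 le_rfl]
  exact constant_of_has_deriv_right_zero
    (fun s hs => (hderiv s hs.1).continuousWithinAt.mono Set.Icc_subset_Ici_self)
    (fun s hs => (hderiv s hs.1).mono (Set.Ici_subset_Ici.mpr hs.1)) t ⟨ht, le_rfl⟩

end
end

section
/- Uniform-in-ħ first-order estimate for the von Neumann equation in Weyl variables: let V : ℝ → ℝ be of class C² with ‖V''‖_∞ < ∞, let ħ > 0, let R be a strong solution of the von Neumann equation in Weyl variables with parameter ħ, and set L := max(1, ‖V''‖_∞). Then for every t ≥ 0, ‖∂_x R(t,·,·)‖_{L²(ℝ²)} + ‖y R(t,·,·)‖_{L²(ℝ²)} ≤ (‖∂_x R(0,·,·)‖_{L²(ℝ²)} + ‖y R(0,·,·)‖_{L²(ℝ²)}) e^{L t}. -/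
open MeasureTheory

noncomputable section

section EnergyEstimate

open scoped SchwartzMap LineDeriv

/-- Line derivatives of a Schwartz function commute. -/
lemma SchwartzMap.lineDerivOp_comm {E F : Type*} [NormedAddCommGroup E] [NormedSpace ℝ E]
    [NormedAddCommGroup F] [NormedSpace ℝ F] (f : 𝓢(E, F)) (v w : E) :
    ∂_{v} (∂_{w} f) = ∂_{w} (∂_{v} f) := by
  have key : ∀ (a b : E) (p : E), (∂_{a} (∂_{b} f)) p = fderiv ℝ (fderiv ℝ f) p a b := by
    intro a b p
    have hd : DifferentiableAt ℝ (fderiv ℝ f) p :=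
      ((f.smooth 2).fderiv_right (m := 1) (by norm_num)).differentiable one_ne_zero p
    have hfun : (fun x => (∂_{b} f) x) = fun x => fderiv ℝ f x b :=
      funext fun x => SchwartzMap.lineDerivOp_apply_eq_fderiv b f x
    rw [SchwartzMap.lineDerivOp_apply_eq_fderiv]
    change fderiv ℝ (fun x => (∂_{b} f) x) p a = _
    rw [hfun, fderiv_clm_apply hd (differentiableAt_const b)]
    simp
  ext p
  rw [key, key]
  exact ((f.smooth 2).contDiffAt.isSymmSndFDerivAt (by simp)) v w

/-- The operator `i ∂_v ∂_w` is skew-adjoint on Schwartz functions. -/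
lemma SchwartzMap.integral_inner_I_mul_lineDerivOp_lineDerivOp (u : 𝓢(ℝ × ℝ, ℂ)) (v w : ℝ × ℝ) :
    ∫ p, inner ℝ (u p) (Complex.I * (∂_{v} (∂_{w} u)) p) = 0 := by
  let B : ℂ →L[ℝ] ℂ →L[ℝ] ℝ :=
    (innerSL ℝ : ℂ →L[ℝ] ℂ →L[ℝ] ℝ).bilinearComp (.id ℝ ℂ)
      (ContinuousLinearMap.mul ℝ ℂ Complex.I)
  have hB : ∀ a b : ℂ, B a b = inner ℝ a (Complex.I * b) := fun a b => rfl
  have hanti : ∀ a b : ℂ, B a b = -B b a := by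
    intro a b
    simp only [hB, Complex.inner, Complex.mul_re, Complex.mul_im, Complex.conj_re,
      Complex.conj_im, Complex.I_re, Complex.I_im]
    ring
  have h1 := SchwartzMap.integral_bilinear_lineDerivOp_right_eq_neg_left (μ := volume) u (∂_{w} u) B v
  have h2 := SchwartzMap.integral_bilinear_lineDerivOp_right_eq_neg_left (μ := volume) u (∂_{v} u) B w
  have h3 : ∫ p, B ((∂_{w} u) p) ((∂_{v} u) p) = -∫ p, B ((∂_{v} u) p) ((∂_{w} u) p) := by
    rw [← integral_neg]
    exact integral_congr_ae (Filter.Eventually.of_forall fun p => hanti _ _)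
  rw [SchwartzMap.lineDerivOp_comm u w v, h3] at h2
  change ∫ p, B (u p) ((∂_{v} (∂_{w} u)) p) = 0
  linarith

lemma SchwartzMap.integrable_inner_I_mul_lineDerivOp_lineDerivOp (u : 𝓢(ℝ × ℝ, ℂ)) (v w : ℝ × ℝ) :
    Integrable (fun p => inner ℝ (u p) (Complex.I * (∂_{v} (∂_{w} u)) p)) volume := by
  have h1 : Integrable (fun p => ‖(∂_{v} (∂_{w} u)) p‖) volume :=
    (SchwartzMap.integrable _).norm
  obtain ⟨C, hC⟩ := u.decay 0 0
  refine (h1.const_mul C).mono' ?_ (Filter.Eventually.of_forall fun p => ?_)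
  · exact (u.continuous.inner (continuous_const.mul
      (SchwartzMap.continuous _))).aestronglyMeasurable
  · have hu : ‖u p‖ ≤ C := by simpa using hC.2 p
    calc _ ≤ ‖u p‖ * ‖Complex.I * (∂_{v} (∂_{w} u)) p‖ := norm_inner_le_norm _ _
      _ ≤ _ := by
        rw [norm_mul, Complex.norm_I, one_mul]
        gcongr

/-- Cauchy–Schwarz for the moduli of two Schwartz functions. -/
lemma SchwartzMap.integral_norm_mul_norm_le (a b : 𝓢(ℝ × ℝ, ℂ)) :
    Integrable (fun p => ‖a p‖ * ‖b p‖) volume ∧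
      ∫ p, ‖a p‖ * ‖b p‖ ≤ ‖a.toLp 2 volume‖ * ‖b.toLp 2 volume‖ := by
  have hnorm : ∀ c : 𝓢(ℝ × ℝ, ℂ), ∃ C : Lp ℝ 2 (volume : Measure (ℝ × ℝ)),
      C =ᵐ[volume] (fun p => ‖c p‖) ∧ ‖C‖ = ‖c.toLp 2 volume‖ := fun c =>
    ⟨(c.memLp 2 volume).norm.toLp, (c.memLp 2 volume).norm.coeFn_toLp, by
      rw [SchwartzMap.norm_toLp, Lp.norm_toLp, eLpNorm_norm]⟩
  obtain ⟨A, hA, hAn⟩ := hnorm a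
  obtain ⟨B, hB, hBn⟩ := hnorm b
  have hAB : (fun p => inner ℝ (A p) (B p)) =ᵐ[volume] fun p => ‖a p‖ * ‖b p‖ := by
    filter_upwards [hA, hB] with p h1 h2
    rw [h1, h2]
    simp [mul_comm]
  refine ⟨(L2.integrable_inner (𝕜 := ℝ) A B).congr hAB, ?_⟩
  rw [← integral_congr_ae hAB, ← hAn, ← hBn, ← L2.inner_def]
  exact real_inner_le_norm A B

/-- If an `L²` pairing is dominated pointwise by a skew-adjoint contribution plus a product of
Schwartz functions, it is bounded by the product of their norms. -/
lemma inner_Lp_le_of_pointwise {F G : Lp ℂ 2 (volume : Measure (ℝ × ℝ))} {f g : ℝ × ℝ → ℂ}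
    (hF : F =ᵐ[volume] f) (hG : G =ᵐ[volume] g) (u a b : 𝓢(ℝ × ℝ, ℂ)) (v w : ℝ × ℝ) (K : ℝ)
    (hK : 0 ≤ K)
    (h : ∀ p, inner ℝ (f p) (g p) ≤
      inner ℝ (u p) (Complex.I * (∂_{v} (∂_{w} u)) p) + K * (‖a p‖ * ‖b p‖)) :
    inner ℝ F G ≤ K * (‖a.toLp 2 volume‖ * ‖b.toLp 2 volume‖) := by
  have hint := u.integrable_inner_I_mul_lineDerivOp_lineDerivOp v w
  obtain ⟨hABint, hABle⟩ := a.integral_norm_mul_norm_le b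
  have hFG : (fun p => inner ℝ (F p) (G p)) ≤ᵐ[volume] fun p =>
      inner ℝ (u p) (Complex.I * (∂_{v} (∂_{w} u)) p) + K * (‖a p‖ * ‖b p‖) := by
    filter_upwards [hF, hG] with p h1 h2
    rw [h1, h2]
    exact h p
  have hle := integral_mono_ae (L2.integrable_inner (𝕜 := ℝ) F G)
    (hint.add (hABint.const_mul K)) hFG
  have heq : ∫ p, (inner ℝ (u p) (Complex.I * (∂_{v} (∂_{w} u)) p) + K * (‖a p‖ * ‖b p‖)) =
      K * ∫ p, ‖a p‖ * ‖b p‖ := by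
    rw [integral_add hint (hABint.const_mul K),
      SchwartzMap.integral_inner_I_mul_lineDerivOp_lineDerivOp, zero_add, integral_const_mul]
  rw [L2.inner_def]
  exact hle.trans (heq.trans_le (mul_le_mul_of_nonneg_left hABle hK))

lemma SchwartzMap.hasDerivAt_fst (F : 𝓢(ℝ × ℝ, ℂ)) (x y : ℝ) :
    HasDerivAt (fun x' => F (x', y)) ((∂_{((1, 0) : ℝ × ℝ)} F) (x, y)) x := by
  rw [SchwartzMap.lineDerivOp_apply_eq_fderiv]
  exact (F.hasFDerivAt (x, y)).comp_hasDerivAt x ((hasDerivAt_id x).prodMk (hasDerivAt_const x y))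

lemma SchwartzMap.hasDerivAt_snd (F : 𝓢(ℝ × ℝ, ℂ)) (x y : ℝ) :
    HasDerivAt (fun y' => F (x, y')) ((∂_{((0, 1) : ℝ × ℝ)} F) (x, y)) y := by
  rw [SchwartzMap.lineDerivOp_apply_eq_fderiv]
  exact (F.hasFDerivAt (x, y)).comp_hasDerivAt y ((hasDerivAt_const y x).prodMk (hasDerivAt_id y))

lemma pd2_one_zero_schwartz (F : 𝓢(ℝ × ℝ, ℂ)) (x y : ℝ) :
    pd2 1 0 (fun x y => F (x, y)) x y = (∂_{((1, 0) : ℝ × ℝ)} F) (x, y) := by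
  simp only [pd2, iteratedDeriv_zero, iteratedDeriv_one]
  exact (F.hasDerivAt_fst x y).deriv

lemma pd2_one_one_schwartz (F : 𝓢(ℝ × ℝ, ℂ)) (x y : ℝ) :
    pd2 1 1 (fun x y => F (x, y)) x y =
      (∂_{((1, 0) : ℝ × ℝ)} (∂_{((0, 1) : ℝ × ℝ)} F)) (x, y) := by
  simp only [pd2, iteratedDeriv_one, (F.hasDerivAt_snd _ _).deriv]
  exact ((∂_{((0, 1) : ℝ × ℝ)} F).hasDerivAt_fst x y).deriv

/-- Multiplication of a Schwartz function by the second coordinate. -/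
def mulSnd (F : 𝓢(ℝ × ℝ, ℂ)) : 𝓢(ℝ × ℝ, ℂ) :=
  SchwartzMap.smulLeftCLM ℂ (fun p : ℝ × ℝ => p.2) F

lemma mulSnd_apply (F : 𝓢(ℝ × ℝ, ℂ)) (p : ℝ × ℝ) : mulSnd F p = (p.2 : ℂ) * F p := by
  have hg : (fun p : ℝ × ℝ => p.2).HasTemperateGrowth :=
    (ContinuousLinearMap.snd ℝ ℝ ℝ).hasTemperateGrowth
  rw [mulSnd, SchwartzMap.smulLeftCLM_apply_apply hg, Complex.real_smul]

lemma mulSnd_mixed (F : 𝓢(ℝ × ℝ, ℂ)) (p : ℝ × ℝ) :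
    (∂_{((1, 0) : ℝ × ℝ)} (∂_{((0, 1) : ℝ × ℝ)} (mulSnd F))) p =
      (∂_{((1, 0) : ℝ × ℝ)} F) p +
        (p.2 : ℂ) * (∂_{((1, 0) : ℝ × ℝ)} (∂_{((0, 1) : ℝ × ℝ)} F)) p := by
  obtain ⟨x, y⟩ := p
  have h1 : ∀ x y, (∂_{((0, 1) : ℝ × ℝ)} (mulSnd F)) (x, y) =
      F (x, y) + (y : ℂ) * (∂_{((0, 1) : ℝ × ℝ)} F) (x, y) := by
    intro x y
    refine ((mulSnd F).hasDerivAt_snd x y).unique ?_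
    simp only [mulSnd_apply]
    have h := (hasDerivAt_id y).ofReal_comp.mul (F.hasDerivAt_snd x y)
    rw [Complex.ofReal_one, one_mul] at h
    exact h
  refine ((∂_{((0, 1) : ℝ × ℝ)} (mulSnd F)).hasDerivAt_fst x y).unique ?_
  simp only [h1]
  exact (F.hasDerivAt_fst x y).add
    (((∂_{((0, 1) : ℝ × ℝ)} F).hasDerivAt_fst x y).const_mul (y : ℂ))

/-- The centred difference quotient of the potential has `x`-derivative controlled by `|y|`. -/
lemma exists_hasDerivAt_centredDiff (V : ℝ → ℝ) (hV : ContDiff ℝ 2 V)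
    (hVb : ∃ C : ℝ, ∀ x : ℝ, |iteratedDeriv 2 V x| ≤ C) (hbar : ℝ) (hh : 0 < hbar) (x y : ℝ) :
    ∃ w : ℝ, HasDerivAt
        (fun x => (V (x + hbar * y / 2) - V (x - hbar * y / 2)) / hbar) w x ∧
      |w| ≤ supN (iteratedDeriv 2 V) * |y| := by
  have hV1 : Differentiable ℝ V := hV.differentiable two_ne_zero
  have hV2 : Differentiable ℝ (deriv V) :=
    ((contDiff_succ_iff_deriv (n := 1)).1 hV).2.2.differentiable one_ne_zero
  have hbdd : ∀ z, ‖deriv (deriv V) z‖ ≤ supN (iteratedDeriv 2 V) := by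
    intro z
    obtain ⟨C, hC⟩ := hVb
    have : |iteratedDeriv 2 V z| ≤ supN (iteratedDeriv 2 V) :=
      le_ciSup (f := fun z => |iteratedDeriv 2 V z|) ⟨C, by rintro _ ⟨z, rfl⟩; exact hC z⟩ z
    simpa [iteratedDeriv_succ] using this
  have hlip : ‖deriv V (x + hbar * y / 2) - deriv V (x - hbar * y / 2)‖ ≤
      supN (iteratedDeriv 2 V) * ‖(x + hbar * y / 2) - (x - hbar * y / 2)‖ :=
    convex_univ.norm_image_sub_le_of_norm_deriv_le (fun z _ => hV2 z) (fun z _ => hbdd z)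
      (Set.mem_univ _) (Set.mem_univ _)
  refine ⟨(deriv V (x + hbar * y / 2) - deriv V (x - hbar * y / 2)) / hbar, ?_, ?_⟩
  · exact ((hV1 _).hasDerivAt.comp_add_const x _ |>.sub
      ((hV1 _).hasDerivAt.comp_sub_const x _)).div_const hbar
  · rw [abs_div, abs_of_pos hh, div_le_iff₀ hh]
    refine hlip.trans_eq ?_
    rw [show (x + hbar * y / 2) - (x - hbar * y / 2) = hbar * y by ring, Real.norm_eq_abs,
      abs_mul, abs_of_pos hh]
    ring

lemma real_inner_mul_I_mul_self (r : ℝ) (z : ℂ) : inner ℝ z (Complex.I * (r : ℂ) * z) = 0 := by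
  simp only [Complex.inner, Complex.mul_re, Complex.mul_im, Complex.conj_re, Complex.conj_im,
    Complex.I_re, Complex.I_im, Complex.ofReal_re, Complex.ofReal_im]
  ring

/-- Grönwall-type bound for the sum of two norms whose squares satisfy coupled differential
inequalities. -/
lemma norm_add_norm_le_exp {E : Type*} [NormedAddCommGroup E] [InnerProductSpace ℝ E]
    (f f' g g' : ℝ → E) (L : ℝ) (hL : 0 ≤ L)
    (hf : ∀ t, 0 ≤ t → HasDerivWithinAt f (f' t) (Set.Ici 0) t)
    (hg : ∀ t, 0 ≤ t → HasDerivWithinAt g (g' t) (Set.Ici 0) t)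
    (hf' : ∀ t, 0 ≤ t → inner ℝ (f t) (f' t) ≤ L * (‖g t‖ * ‖f t‖))
    (hg' : ∀ t, 0 ≤ t → inner ℝ (g t) (g' t) ≤ L * (‖f t‖ * ‖g t‖)) (t : ℝ) (ht : 0 ≤ t) :
    ‖f t‖ + ‖g t‖ ≤ (‖f 0‖ + ‖g 0‖) * Real.exp (L * t) := by
  have hsqrt : ∀ (k k' : ℝ → E), (∀ t, 0 ≤ t → HasDerivWithinAt k (k' t) (Set.Ici 0) t) →
      ∀ ε > 0, ∀ t, 0 ≤ t → HasDerivWithinAt (fun s => √(‖k s‖ ^ 2 + ε))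
        (inner ℝ (k t) (k' t) / √(‖k t‖ ^ 2 + ε)) (Set.Ici 0) t := by
    intro k k' hk ε hε t ht
    convert! ((hk t ht).norm_sq.add_const ε).sqrt (by positivity) using 1
    field_simp
  have hrate : ∀ (z z' w : E) (ε : ℝ), 0 < ε → inner ℝ z z' ≤ L * (‖w‖ * ‖z‖) →
      inner ℝ z z' / √(‖z‖ ^ 2 + ε) ≤ L * √(‖w‖ ^ 2 + ε) := by
    intro z z' w ε hε h
    have h1 : ‖w‖ ≤ √(‖w‖ ^ 2 + ε) := Real.le_sqrt_of_sq_le (by linarith)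
    have h2 : ‖z‖ ≤ √(‖z‖ ^ 2 + ε) := Real.le_sqrt_of_sq_le (by linarith)
    rw [div_le_iff₀ (by positivity), mul_assoc]
    exact h.trans (by gcongr)
  have hreg : ∀ ε > 0, √(‖f t‖ ^ 2 + ε) + √(‖g t‖ ^ 2 + ε) ≤
      (√(‖f 0‖ ^ 2 + ε) + √(‖g 0‖ ^ 2 + ε)) * Real.exp (L * t) := by
    intro ε hε
    have hderiv : ∀ s, 0 ≤ s → HasDerivWithinAt
        (fun s => (√(‖f s‖ ^ 2 + ε) + √(‖g s‖ ^ 2 + ε)) * Real.exp (-(L * s)))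
        ((inner ℝ (f s) (f' s) / √(‖f s‖ ^ 2 + ε) + inner ℝ (g s) (g' s) / √(‖g s‖ ^ 2 + ε)) *
            Real.exp (-(L * s)) +
          (√(‖f s‖ ^ 2 + ε) + √(‖g s‖ ^ 2 + ε)) * (Real.exp (-(L * s)) * -(L * 1)))
        (Set.Ici 0) s := fun s hs =>
      ((hsqrt f f' hf ε hε s hs).add (hsqrt g g' hg ε hε s hs)).mul
        (((hasDerivAt_id s).const_mul L).neg.exp.hasDerivWithinAt)
    have hanti : AntitoneOn
        (fun s => (√(‖f s‖ ^ 2 + ε) + √(‖g s‖ ^ 2 + ε)) * Real.exp (-(L * s))) (Set.Ici 0) := by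
      refine antitoneOn_of_hasDerivWithinAt_nonpos (convex_Ici 0)
        (fun s hs => (hderiv s hs).continuousWithinAt)
        (fun s hs => (hderiv s (interior_subset hs)).mono interior_subset) fun s hs => ?_
      have hs0 : 0 ≤ s := interior_subset hs
      have h1 := hrate _ _ _ ε hε (hf' s hs0)
      have h2 := hrate _ _ _ ε hε (hg' s hs0)
      nlinarith [Real.exp_pos (-(L * s))]
    have h0 := hanti (Set.mem_Ici.2 le_rfl) (Set.mem_Ici.2 ht) ht
    simp only [mul_zero, neg_zero, Real.exp_zero, mul_one, Real.exp_neg] at h0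
    rwa [← div_eq_mul_inv, div_le_iff₀ (Real.exp_pos _)] at h0
  have hlim : ∀ z : E, Filter.Tendsto (fun ε : ℝ => √(‖z‖ ^ 2 + ε)) (nhdsWithin 0 (Set.Ioi 0))
      (nhds ‖z‖) := by
    intro z
    have hc : Continuous fun ε : ℝ => √(‖z‖ ^ 2 + ε) := by fun_prop
    simpa using (hc.tendsto 0).mono_left nhdsWithin_le_nhds
  exact le_of_tendsto_of_tendsto ((hlim _).add (hlim _)) (((hlim _).add (hlim _)).mul_const _)
    (eventually_nhdsWithin_of_forall hreg)

/-- The Schwartz function underlying a two-variable function satisfying `IsSchwartz2`. -/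
def IsSchwartz2.toSchwartz {f : ℝ → ℝ → ℂ} (hf : IsSchwartz2 f) : 𝓢(ℝ × ℝ, ℂ) where
  toFun := unc f
  smooth' := hf.1
  decay' := hf.2

/-- Energy inequalities at a fixed time for the von Neumann evolution. -/
lemma vonNeumann_energy_inequalities (V : ℝ → ℝ) (hV : ContDiff ℝ 2 V)
    (hVb : ∃ C : ℝ, ∀ x : ℝ, |iteratedDeriv 2 V x| ≤ C) (hbar : ℝ) (hh : 0 < hbar)
    (f g : ℝ → ℝ → ℂ) (hf : IsSchwartz2 f)
    (hg : ∀ x y, g x y = Complex.I * pd2 1 1 f x y -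
      Complex.I * (((V (x + hbar * y / 2) - V (x - hbar * y / 2)) / hbar : ℝ) : ℂ) * f x y)
    (A A' B B' : Lp ℂ 2 (volume : Measure (ℝ × ℝ)))
    (hA : A =ᵐ[volume] unc (wD 0 1 0 0 f)) (hA' : A' =ᵐ[volume] unc (wD 0 1 0 0 g))
    (hB : B =ᵐ[volume] unc (wD 0 0 1 0 f)) (hB' : B' =ᵐ[volume] unc (wD 0 0 1 0 g)) :
    inner ℝ A A' ≤ supN (iteratedDeriv 2 V) * (‖B‖ * ‖A‖) ∧ inner ℝ B B' ≤ ‖A‖ * ‖B‖ := by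
  obtain ⟨F, hF⟩ : ∃ F : 𝓢(ℝ × ℝ, ℂ), f = fun x y => F (x, y) := ⟨hf.toSchwartz, rfl⟩
  subst hF
  set D := ∂_{((1, 0) : ℝ × ℝ)} F with hD
  have hfx : unc (wD 0 1 0 0 fun x y => F (x, y)) = D := by
    funext p
    simp [unc, wD, pd2_one_zero_schwartz, hD]
  have hyf : unc (wD 0 0 1 0 fun x y => F (x, y)) = mulSnd F := by
    funext p
    simp [unc, wD, pd2, mulSnd_apply]
  have hAn : ‖A‖ = ‖D.toLp 2 volume‖ := by
    rw [SchwartzMap.norm_toLp, Lp.norm_def, eLpNorm_congr_ae hA, hfx]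
  have hBn : ‖B‖ = ‖(mulSnd F).toLp 2 volume‖ := by
    rw [SchwartzMap.norm_toLp, Lp.norm_def, eLpNorm_congr_ae hB, hyf]
  have hS : 0 ≤ supN (iteratedDeriv 2 V) := Real.iSup_nonneg fun _ => abs_nonneg _
  rw [hAn, hBn]
  constructor
  · refine inner_Lp_le_of_pointwise hA hA' D (mulSnd F) D (1, 0) (0, 1) _ hS ?_
    rintro ⟨x, y⟩
    obtain ⟨w, hw, hwy⟩ := exists_hasDerivAt_centredDiff V hV hVb hbar hh x y
    have hgx : unc (wD 0 1 0 0 g) (x, y) =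
        Complex.I * (∂_{((1, 0) : ℝ × ℝ)} (∂_{((0, 1) : ℝ × ℝ)} D)) (x, y) -
          (Complex.I * (w : ℂ) * F (x, y) + Complex.I *
            (((V (x + hbar * y / 2) - V (x - hbar * y / 2)) / hbar : ℝ) : ℂ) * D (x, y)) := by
      simp only [unc, wD, pow_zero, one_mul, pd2, iteratedDeriv_zero, iteratedDeriv_one]
      refine HasDerivAt.deriv ?_
      simp only [hg, pd2_one_one_schwartz]
      rw [hD, SchwartzMap.lineDerivOp_comm F (0, 1) (1, 0)]
      exact (((∂_{((1, 0) : ℝ × ℝ)} (∂_{((0, 1) : ℝ × ℝ)} F)).hasDerivAt_fst x y).const_mul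
        Complex.I).sub ((hw.ofReal_comp.const_mul Complex.I).mul (F.hasDerivAt_fst x y))
    rw [hgx, hfx, inner_sub_right, inner_add_right, real_inner_mul_I_mul_self, add_zero,
      sub_eq_add_neg]
    gcongr
    calc -inner ℝ (D (x, y)) (Complex.I * (w : ℂ) * F (x, y))
        ≤ ‖D (x, y)‖ * ‖Complex.I * (w : ℂ) * F (x, y)‖ :=
          (neg_le_abs _).trans (abs_real_inner_le_norm _ _)
      _ = |w| * ‖F (x, y)‖ * ‖D (x, y)‖ := by
          simp only [norm_mul, Complex.norm_I, Complex.norm_real, Real.norm_eq_abs]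
          ring
      _ ≤ supN (iteratedDeriv 2 V) * |y| * ‖F (x, y)‖ * ‖D (x, y)‖ := by gcongr
      _ = _ := by
          simp only [mulSnd_apply, norm_mul, Complex.norm_real, Real.norm_eq_abs]
          ring
  · rw [← one_mul (‖D.toLp 2 volume‖ * _)]
    refine inner_Lp_le_of_pointwise hB hB' (mulSnd F) D (mulSnd F) (1, 0) (0, 1) _ zero_le_one ?_
    rintro ⟨x, y⟩
    have hgy : unc (wD 0 0 1 0 g) (x, y) =
        Complex.I * (∂_{((1, 0) : ℝ × ℝ)} (∂_{((0, 1) : ℝ × ℝ)} (mulSnd F))) (x, y) -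
          (Complex.I * D (x, y) + Complex.I *
            (((V (x + hbar * y / 2) - V (x - hbar * y / 2)) / hbar : ℝ) : ℂ) *
              mulSnd F (x, y)) := by
      simp only [unc, wD, pd2, iteratedDeriv_zero, pow_zero, pow_one, one_mul, hg, mulSnd_mixed,
        mulSnd_apply]
      rw [← pd2_one_one_schwartz F x y]
      simp only [pd2, iteratedDeriv_one]
      ring
    rw [hgy, hyf, inner_sub_right, inner_add_right, real_inner_mul_I_mul_self, add_zero,
      sub_eq_add_neg]
    gcongr
    calc -inner ℝ (mulSnd F (x, y)) (Complex.I * D (x, y))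
        ≤ ‖mulSnd F (x, y)‖ * ‖Complex.I * D (x, y)‖ :=
          (neg_le_abs _).trans (abs_real_inner_le_norm _ _)
      _ = _ := by
          simp only [norm_mul, Complex.norm_I]
          ring

end EnergyEstimate

/-- Uniform-in-`ħ` first-order estimate for the von Neumann equation in Weyl
variables: bound on `‖∂_x R(t)‖_{L²} + ‖y R(t)‖_{L²}`. -/
theorem vonNeumann_first_order_estimate (V : ℝ → ℝ) (hV : ContDiff ℝ 2 V)
    (hVb : ∃ C : ℝ, ∀ x : ℝ, |iteratedDeriv 2 V x| ≤ C)
    (hbar : ℝ) (hh : 0 < hbar) (R : ℝ → ℝ → ℝ → ℂ) (hR : IsVNSol hbar V R) :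
    ∀ t : ℝ, 0 ≤ t →
      L2 (wD 0 1 0 0 (R t)) + L2 (wD 0 0 1 0 (R t)) ≤
        (L2 (wD 0 1 0 0 (R 0)) + L2 (wD 0 0 1 0 (R 0))) *
          Real.exp (max 1 (supN (iteratedDeriv 2 V)) * t) := by
  obtain ⟨⟨-, hS, hC⟩, heq⟩ := hR
  obtain ⟨A, A', hA, hA', hAd, -⟩ := hC 0 1 0 0
  obtain ⟨B, B', hB, hB', hBd, -⟩ := hC 0 0 1 0
  have hAn : ∀ t, 0 ≤ t → L2 (wD 0 1 0 0 (R t)) = ‖A t‖ := fun t ht => by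
    rw [L2, Lp.norm_def, eLpNorm_congr_ae (hA t ht)]
  have hBn : ∀ t, 0 ≤ t → L2 (wD 0 0 1 0 (R t)) = ‖B t‖ := fun t ht => by
    rw [L2, Lp.norm_def, eLpNorm_congr_ae (hB t ht)]
  have hE := fun (t : ℝ) (ht : 0 ≤ t) =>
    vonNeumann_energy_inequalities V hV hVb hbar hh (R t) (dtR R t) (hS t ht) (heq t ht)
      (A t) (A' t) (B t) (B' t) (hA t ht) (hA' t ht) (hB t ht) (hB' t ht)
  intro t ht
  rw [hAn t ht, hBn t ht, hAn 0 le_rfl, hBn 0 le_rfl]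
  refine norm_add_norm_le_exp A A' B B' _ (zero_le_one.trans (le_max_left _ _)) hAd hBd
    (fun s hs => (hE s hs).1.trans ?_) (fun s hs => (hE s hs).2.trans ?_) t ht
  · gcongr
    exact le_max_right _ _
  · exact le_mul_of_one_le_left (by positivity) (le_max_left _ _)

end
end
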